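/- arXiv:2411.11815 — 4 statements merged into one kernel-verified Lean document; each statement's English description precedes it below -/
import Mathlib

section
/- Let m and n be positive integers and let ε ∈ {1, -1}. Then Σ_{λ ∈ P(n)} ε^{t_m(λ)+t_{2m}(λ)+t_{3m}(λ)+⋯} Σ_{i≥0} Σ_{j=1}^{m-1} (im+j) t_{im+j}(λ) = Σ_{λ ∈ P(n)} ε^{⌊t_1(λ)/m⌋+⌊t_2(λ)/m⌋+⋯+⌊t_n(λ)/m⌋} (⟨t_1(λ)⟩_m + 2⟨t_2(λ)⟩_m + ⋯ + n⟨t_n(λ)⟩_m), where both sums run over all partitions λ of n; the inner double sum on the left is the sum of i·t_i(λ) over all i not divisible by m. -/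
/-- Summing over the partitions `p` of `n` when every multiset `s` decomposes uniquely as
`s = u s + h (v s)` with `P (u s)`, where `h` multiplies the sum by `m`. -/
theorem Nat.Partition.sum_eq_sum_of_decomposition {M : Type*} [AddCommMonoid M] {m n : ℕ}
    (hm : 0 < m)
    (u v h : Multiset ℕ → Multiset ℕ) (P : Multiset ℕ → Prop) [DecidablePred P]
    (huv : ∀ s, u s + h (v s) = s) (hP : ∀ s, P (u s))
    (hu : ∀ a b, P a → u (a + h b) = a) (hv : ∀ a b, P a → v (a + h b) = b)
    (hv0 : ∀ s, 0 ∉ s → 0 ∉ v s) (hh0 : ∀ s, 0 ∉ s → 0 ∉ h s)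
    (hsum : ∀ s, (h s).sum = m * s.sum) (F : Multiset ℕ → Multiset ℕ → M) :
    ∑ p : Nat.Partition n, F (u p.parts) (v p.parts) =
      ∑ x ∈ (Finset.range (n + 1) ×ˢ Finset.range (n + 1)).filter
          (fun x => x.1 + m * x.2 = n),
        ∑ α ∈ (Finset.univ : Finset (Nat.Partition x.1)).filter (fun α => P α.parts),
          ∑ β : Nat.Partition x.2, F α.parts β.parts := by
  have zero_notMem {k : ℕ} (p : Nat.Partition k) : 0 ∉ p.parts :=
    fun h0 => lt_irrefl 0 (p.parts_pos h0)
  simp_rw [← Finset.sum_product']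
  rw [Finset.sum_sigma']
  symm
  refine Finset.sum_bij
    (fun x hx => (⟨x.2.1.parts + h x.2.2.parts, ?_, ?_⟩ : Nat.Partition n)) ?_ ?_ ?_ ?_
  · intro i hi
    rcases Multiset.mem_add.1 hi with hi | hi
    · exact x.2.1.parts_pos hi
    · exact Nat.pos_of_ne_zero fun h0 => hh0 _ (zero_notMem x.2.2) (h0 ▸ hi)
  · simp only [Finset.mem_sigma, Finset.mem_filter] at hx
    rw [Multiset.sum_add, hsum, x.2.1.parts_sum, x.2.2.parts_sum, hx.1.2]
  · simp
  · rintro ⟨⟨a, b⟩, α, β⟩ hx ⟨⟨a', b'⟩, α', β'⟩ hx' heq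
    simp only [Finset.mem_sigma, Finset.mem_filter, Finset.mem_product, Finset.mem_univ,
      true_and, and_true] at hx hx'
    have heq' : α.parts + h β.parts = α'.parts + h β'.parts := congrArg Nat.Partition.parts heq
    have hα : α.parts = α'.parts := by
      rw [← hu _ β.parts hx.2, heq', hu _ _ hx'.2]
    have hβ : β.parts = β'.parts := by
      rw [← hv _ β.parts hx.2, heq', hv _ _ hx'.2]
    obtain rfl : a = a' := α.parts_sum.symm.trans (hα ▸ α'.parts_sum)
    obtain rfl : b = b' := β.parts_sum.symm.trans (hβ ▸ β'.parts_sum)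
    obtain rfl := Nat.Partition.ext hα
    obtain rfl := Nat.Partition.ext hβ
    rfl
  · intro p _
    have hadd : (u p.parts).sum + m * (v p.parts).sum = n := by
      rw [← hsum, ← Multiset.sum_add, huv, p.parts_sum]
    refine ⟨⟨((u p.parts).sum, (v p.parts).sum), ⟨u p.parts, ?_, rfl⟩, ⟨v p.parts, ?_, rfl⟩⟩,
      ?_, ?_⟩
    · intro i hi
      exact p.parts_pos (huv p.parts ▸ Multiset.mem_add.2 (Or.inl hi))
    · intro i hi
      exact Nat.pos_of_ne_zero fun h0 => hv0 _ (zero_notMem p) (h0 ▸ hi)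
    · have := Nat.le_mul_of_pos_left (v p.parts).sum hm
      simp only [Finset.mem_sigma, Finset.mem_filter, Finset.mem_product, Finset.mem_univ,
        Finset.mem_range, true_and, and_true]
      exact ⟨⟨⟨by omega, by omega⟩, hadd⟩, hP _⟩
    · exact Nat.Partition.ext (huv _)
  · rintro ⟨⟨a, b⟩, α, β⟩ hx
    simp only [Finset.mem_sigma, Finset.mem_filter, Finset.mem_product, Finset.mem_univ,
      true_and, and_true] at hx
    simp only [hu _ _ hx.2, hv _ _ hx.2]

/-- Apply `f` to every multiplicity of a multiset. -/
noncomputable def Multiset.mapCount (f : ℕ → ℕ) (hf : f 0 = 0) (s : Multiset ℕ) : Multiset ℕ :=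
  Finsupp.toMultiset ((Multiset.toFinsupp s).mapRange f hf)

theorem Multiset.count_mapCount (f : ℕ → ℕ) (hf : f 0 = 0) (s : Multiset ℕ) (i : ℕ) :
    (s.mapCount f hf).count i = f (s.count i) := by
  simp [Multiset.mapCount, Finsupp.count_toMultiset]

theorem Multiset.count_map_mul_right {m : ℕ} (hm : 0 < m) (s : Multiset ℕ) (k : ℕ) :
    (s.map (· * m)).count (k * m) = s.count k :=
  Multiset.count_map_eq_count' _ s (fun _ _ h => Nat.eq_of_mul_eq_mul_right hm h) k

theorem Multiset.map_mul_map_div_filter_dvd {m : ℕ} (s : Multiset ℕ) :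
    ((s.filter (m ∣ ·)).map (· / m)).map (· * m) = s.filter (m ∣ ·) := by
  rw [Multiset.map_map]
  conv_rhs => rw [← Multiset.map_id (s.filter (m ∣ ·))]
  refine Multiset.map_congr rfl fun i hi => ?_
  exact Nat.div_mul_cancel (Multiset.mem_filter.1 hi).2

theorem Nat.Partition.sum_count_eq_card_of_le {n : ℕ} {t : Multiset ℕ} (h0 : 0 ∉ t)
    (ht : ∀ i ∈ t, i ≤ n) : ∑ k ∈ Finset.Icc 1 n, t.count k = t.card :=
  Multiset.sum_count_eq_card fun i hi => Finset.mem_Icc.2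
    ⟨Nat.pos_of_ne_zero fun h => h0 (h ▸ hi), ht i hi⟩

/-- The weighted sum attached to a decomposition `s = u s + h (v s)` depends only on the number of
partitions of each integer satisfying `P`. -/
theorem Nat.Partition.sum_pow_card_mul_sum {m n : ℕ} (hm : 0 < m) (ε : ℤ)
    (u v h : Multiset ℕ → Multiset ℕ) (P : Multiset ℕ → Prop) [DecidablePred P]
    (huv : ∀ s, u s + h (v s) = s) (hP : ∀ s, P (u s))
    (hu : ∀ a b, P a → u (a + h b) = a) (hv : ∀ a b, P a → v (a + h b) = b)
    (hv0 : ∀ s, 0 ∉ s → 0 ∉ v s) (hh0 : ∀ s, 0 ∉ s → 0 ∉ h s)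
    (hsum : ∀ s, (h s).sum = m * s.sum) :
    ∑ p : Nat.Partition n, ε ^ (v p.parts).card * ((u p.parts).sum : ℤ) =
      ∑ x ∈ (Finset.range (n + 1) ×ˢ Finset.range (n + 1)).filter
          (fun x => x.1 + m * x.2 = n),
        ((Finset.univ : Finset (Nat.Partition x.1)).filter (fun α => P α.parts)).card *
          ((x.1 : ℤ) * ∑ β : Nat.Partition x.2, ε ^ β.parts.card) := by
  rw [Nat.Partition.sum_eq_sum_of_decomposition hm u v h P huv hP hu hv hv0 hh0 hsum
    (fun α β => ε ^ β.card * (α.sum : ℤ))]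
  refine Finset.sum_congr rfl fun x _ => ?_
  simp only [Nat.Partition.parts_sum, Finset.sum_const, nsmul_eq_mul, ← Finset.sum_mul,
    mul_comm (x.1 : ℤ)]

theorem Multiset.filter_not_dvd_add_map_mul {m : ℕ} (hm : 0 < m) {a : Multiset ℕ}
    (ha : ∀ i ∈ a, ¬ m ∣ i) (b : Multiset ℕ) :
    (a + b.map (· * m)).filter (fun i => ¬ m ∣ i) = a ∧
      ((a + b.map (· * m)).filter (m ∣ ·)).map (· / m) = b := by
  have h1 : (b.map (· * m)).filter (fun i => ¬ m ∣ i) = 0 := by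
    simp [Multiset.filter_eq_nil]
  have h2 : (b.map (· * m)).filter (m ∣ ·) = b.map (· * m) := by
    simp [Multiset.filter_eq_self]
  have h3 : a.filter (m ∣ ·) = 0 := Multiset.filter_eq_nil.2 ha
  rw [Multiset.filter_add, Multiset.filter_add, Multiset.filter_eq_self.2 ha, h1, h2, h3]
  simp [Multiset.map_map, Nat.mul_div_cancel _ hm]

/-- For positive integers `m`, `n` and `ε ∈ {1, -1}`:
`Σ_{λ} ε^(t_m+t_{2m}+⋯) Σ_{m ∤ i} i·t_i = Σ_{λ} ε^(⌊t_1/m⌋+⋯+⌊t_n/m⌋) Σ_i i·⟨t_i⟩_m`,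
where `⟨x⟩_m = x % m`. All terms with index `> n` vanish, so sums may be taken over
`1 ≤ i ≤ n`. -/
theorem stmt_4 (m n : ℕ) (hm : 0 < m) (hn : 0 < n) (ε : ℤ)
    (hε : ε = 1 ∨ ε = -1) :
    ∑ p : Nat.Partition n,
        ε ^ (∑ k ∈ Finset.Icc 1 n, p.parts.count (k * m)) *
          (∑ i ∈ (Finset.Icc 1 n).filter (fun i => ¬ m ∣ i),
            (i : ℤ) * (p.parts.count i : ℤ))
      = ∑ p : Nat.Partition n,
        ε ^ (∑ k ∈ Finset.Icc 1 n, p.parts.count k / m) *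
          (∑ i ∈ Finset.Icc 1 n, (i : ℤ) * ((p.parts.count i % m : ℕ) : ℤ)) := by
  have zero_notMem (p : Nat.Partition n) : 0 ∉ p.parts := fun h0 => lt_irrefl 0 (p.parts_pos h0)
  have mem_Icc (p : Nat.Partition n) {i : ℕ} (hi : i ∈ p.parts) : i ∈ Finset.Icc 1 n :=
    Finset.mem_Icc.2 ⟨p.parts_pos hi, p.le_of_mem_parts hi⟩
  have hv₁ (s : Multiset ℕ) (h0 : 0 ∉ s) : 0 ∉ (s.filter (m ∣ ·)).map (· / m) := by
    intro h
    obtain ⟨i, hi, hi0⟩ := Multiset.mem_map.1 h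
    obtain ⟨his, hdvd⟩ := Multiset.mem_filter.1 hi
    have := Nat.eq_zero_of_dvd_of_div_eq_zero hdvd hi0
    exact h0 (this ▸ his)
  have key₁ := Nat.Partition.sum_pow_card_mul_sum (n := n) hm ε
    (fun s => s.filter (fun i => ¬ m ∣ i)) (fun s => (s.filter (m ∣ ·)).map (· / m))
    (fun s => s.map (· * m)) (fun s => ∀ i ∈ s, ¬ m ∣ i)
    (fun s => by
      rw [Multiset.map_mul_map_div_filter_dvd, add_comm, Multiset.filter_add_not])
    (fun s i hi => (Multiset.mem_filter.1 hi).2)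
    (fun a b ha => (Multiset.filter_not_dvd_add_map_mul hm ha b).1)
    (fun a b ha => (Multiset.filter_not_dvd_add_map_mul hm ha b).2)
    hv₁
    (fun s h0 h => by
      obtain ⟨i, hi, hi0⟩ := Multiset.mem_map.1 h
      have : i = 0 := (Nat.mul_eq_zero.1 hi0).resolve_right hm.ne'
      exact h0 (this ▸ hi))
    (fun s => by rw [Multiset.sum_map_mul_right, Multiset.map_id', mul_comm])
  have key₂ := Nat.Partition.sum_pow_card_mul_sum (n := n) hm ε
    (Multiset.mapCount (· % m) (Nat.zero_mod m)) (Multiset.mapCount (· / m) (Nat.zero_div m))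
    (fun s => m • s) (fun s => ∀ i ∈ s, s.count i < m)
    (fun s => by
      ext i
      simp only [Multiset.count_add, Multiset.count_nsmul, Multiset.count_mapCount]
      exact Nat.mod_add_div _ _)
    (fun s i _ => by
      rw [Multiset.count_mapCount]
      exact Nat.mod_lt _ hm)
    (fun a b ha => by
      ext i
      have : a.count i < m := by
        by_cases hi : i ∈ a
        · exact ha i hi
        · rwa [Multiset.count_eq_zero_of_notMem hi]
      simp only [Multiset.count_add, Multiset.count_nsmul, Multiset.count_mapCount]
      simp [Nat.mod_eq_of_lt this])
    (fun a b ha => by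
      ext i
      have : a.count i < m := by
        by_cases hi : i ∈ a
        · exact ha i hi
        · rwa [Multiset.count_eq_zero_of_notMem hi]
      simp only [Multiset.count_add, Multiset.count_nsmul, Multiset.count_mapCount]
      simp [Nat.add_mul_div_left _ _ hm, Nat.div_eq_of_lt this])
    (fun s h0 => by
      rw [← Multiset.count_eq_zero] at h0 ⊢
      simp [Multiset.count_mapCount, h0])
    (fun s h0 h => h0 (Multiset.mem_of_mem_nsmul h))
    (fun s => by rw [Multiset.sum_nsmul, smul_eq_mul])
  calc
    _ = _ := Finset.sum_congr rfl fun p _ => ?_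
    _ = _ := key₁
    _ = _ := Finset.sum_congr rfl fun x _ => ?_
    _ = _ := key₂.symm
    _ = _ := Finset.sum_congr rfl fun p _ => ?_
  · congr 1
    · rw [← Nat.Partition.sum_count_eq_card_of_le (n := n) (hv₁ _ (zero_notMem p))]
      · congr 1
        refine Finset.sum_congr rfl fun k _ => ?_
        rw [← Multiset.count_map_mul_right hm (Multiset.map _ _), Multiset.map_mul_map_div_filter_dvd,
          Multiset.count_filter_of_pos (dvd_mul_left m k)]
      · intro i hi
        obtain ⟨j, hj, rfl⟩ := Multiset.mem_map.1 hi
        exact (Nat.div_le_self _ _).trans (p.le_of_mem_parts (Multiset.mem_filter.1 hj).1)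
    · rw [Finset.sum_multiset_count_of_subset _ ((Finset.Icc 1 n).filter (fun i => ¬ m ∣ i))]
      · push_cast
        refine Finset.sum_congr rfl fun i hi => ?_
        rw [Multiset.count_filter_of_pos (p := fun i => ¬ m ∣ i) (Finset.mem_filter.1 hi).2]
        simp [mul_comm]
      · intro i hi
        have hi' := Multiset.mem_filter.1 (Multiset.mem_toFinset.1 hi)
        exact Finset.mem_filter.2 ⟨mem_Icc p hi'.1, hi'.2⟩
  · congr 2
    exact Nat.Partition.card_restricted_eq_card_countRestricted x.1 hm
  · have mem_of_mem_mapCount {f : ℕ → ℕ} {hf : f 0 = 0} {i : ℕ}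
        (hi : i ∈ p.parts.mapCount f hf) : i ∈ p.parts := by
      rw [← Multiset.count_ne_zero, Multiset.count_mapCount] at hi
      exact Multiset.count_ne_zero.1 fun h => hi (h ▸ hf)
    congr 1
    · rw [← Nat.Partition.sum_count_eq_card_of_le (n := n)
        (fun h => zero_notMem p (mem_of_mem_mapCount h))
        (fun i hi => p.le_of_mem_parts (mem_of_mem_mapCount hi))]
      simp only [Multiset.count_mapCount]
    · rw [Finset.sum_multiset_count_of_subset _ (Finset.Icc 1 n)
        (fun i hi => mem_Icc p (mem_of_mem_mapCount (Multiset.mem_toFinset.1 hi)))]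
      simp [Multiset.count_mapCount, mul_comm]
end

section
/- Let m, n, and k be positive integers. Then Σ_{λ ∈ P(n)} t_{km}(λ) = Σ_{λ ∈ P(n)} ⌊t_1(λ)/(km)⌋, where both sums run over all partitions λ of n. -/
/-- Replace a submultiset `s` of the parts of a partition by a multiset `t` of positive integers
with the same sum. -/
def Nat.Partition.exchange {n : ℕ} (p : Nat.Partition n) (s t : Multiset ℕ)
    (ht : ∀ i ∈ t, 0 < i) (hst : s.sum = t.sum) (hs : s ≤ p.parts) : Nat.Partition n where
  parts := p.parts - s + t
  parts_pos := by
    intro i hi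
    rcases Multiset.mem_add.1 hi with h | h
    · exact p.parts_pos (Multiset.mem_of_le (Multiset.sub_le_self _ _) h)
    · exact ht i h
  parts_sum := by
    rw [Multiset.sum_add, ← hst, ← Multiset.sum_add, Multiset.sub_add_cancel hs, p.parts_sum]

/-- The number of partitions of `n` containing a given multiset of positive integers among their
parts depends only on the sum of that multiset. -/
theorem Nat.Partition.card_filter_le_parts_congr (n : ℕ) {s t : Multiset ℕ}
    (hs : ∀ i ∈ s, 0 < i) (ht : ∀ i ∈ t, 0 < i) (hst : s.sum = t.sum) :
    (Finset.univ.filter fun p : Nat.Partition n => s ≤ p.parts).card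
      = (Finset.univ.filter fun p : Nat.Partition n => t ≤ p.parts).card := by
  refine Finset.card_bij'
    (fun p hp => p.exchange s t ht hst (Finset.mem_filter.1 hp).2)
    (fun p hp => p.exchange t s hs hst.symm (Finset.mem_filter.1 hp).2) ?_ ?_ ?_ ?_
  · intro p _
    simp [exchange]
  · intro p _
    simp [exchange]
  · intro p hp
    ext1
    simp [exchange, Multiset.sub_add_cancel (Finset.mem_filter.1 hp).2]
  · intro p hp
    ext1
    simp [exchange, Multiset.sub_add_cancel (Finset.mem_filter.1 hp).2]

theorem Nat.Partition.count_parts_le {n : ℕ} (p : Nat.Partition n) (i : ℕ) :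
    p.parts.count i ≤ n := by
  have h : p.parts.card ≤ p.parts.sum := by
    simpa using Multiset.card_nsmul_le_sum (s := p.parts) (a := 1) fun i hi => p.parts_pos hi
  exact (Multiset.count_le_card _ _).trans (h.trans_eq p.parts_sum)

theorem Finset.sum_eq_sum_card_filter_le {α : Type*} (s : Finset α) (f : α → ℕ) (N : ℕ)
    (hf : ∀ a ∈ s, f a ≤ N) :
    ∑ a ∈ s, f a = ∑ j ∈ Finset.Icc 1 N, (s.filter fun a => j ≤ f a).card := by
  simp_rw [Finset.card_filter]
  rw [Finset.sum_comm]
  refine Finset.sum_congr rfl fun a ha => ?_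
  rw [← Finset.card_filter]
  have h : (Finset.Icc 1 N).filter (fun j => j ≤ f a) = Finset.Icc 1 (f a) := by
    ext j
    have := hf a ha
    simp only [Finset.mem_filter, Finset.mem_Icc]
    omega
  simp [h]

/-- For positive integers `m`, `n`, `k`:
`Σ_{λ ∈ P(n)} t_{km}(λ) = Σ_{λ ∈ P(n)} ⌊t_1(λ)/(km)⌋`. -/
theorem stmt_11 (m n k : ℕ) (hm : 0 < m) (hn : 0 < n) (hk : 0 < k) :
    ∑ p : Nat.Partition n, p.parts.count (k * m)
      = ∑ p : Nat.Partition n, p.parts.count 1 / (k * m) := by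
  have hd : 0 < k * m := Nat.mul_pos hk hm
  rw [Finset.sum_eq_sum_card_filter_le _ _ n fun p _ => p.count_parts_le _,
    Finset.sum_eq_sum_card_filter_le _ _ n fun p _ =>
      (Nat.div_le_self _ _).trans (p.count_parts_le _)]
  refine Finset.sum_congr rfl fun j _ => ?_
  simp_rw [Nat.le_div_iff_mul_le hd, Multiset.le_count_iff_replicate_le]
  refine Nat.Partition.card_filter_le_parts_congr n (fun i hi => ?_) (fun i hi => ?_) (by simp)
  · rwa [Multiset.eq_of_mem_replicate hi]
  · rw [Multiset.eq_of_mem_replicate hi]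
    exact Nat.one_pos
end

section
/- Let m, n, and k be positive integers. Then Σ_{λ ∈ P(n)} (-1)^{t_m(λ)+t_{2m}(λ)+t_{3m}(λ)+⋯} t_{km}(λ) = Σ_{λ ∈ P(n)} (-1)^{⌊t_1(λ)/m⌋+⌊t_2(λ)/m⌋+⌊t_3(λ)/m⌋+⋯} ⌊t_k(λ)/m⌋, where both sums run over all partitions λ of n. -/
open Finset in
/-- Removing a fixed submultiset `μ` from the partitions of `n` that contain it leaves arbitrary
partitions of `n - μ.sum`. -/
theorem Nat.Partition.card_filter_le_parts {n b : ℕ} (μ : Multiset ℕ) (hμ : ∀ i ∈ μ, 0 < i)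
    (hb : μ.sum + b = n) (Q : Multiset ℕ → Prop) [DecidablePred Q] :
    #{p : Nat.Partition n | μ ≤ p.parts ∧ Q (p.parts - μ)} =
      #{q : Nat.Partition b | Q q.parts} := by
  symm
  refine card_bij (fun q _ => ⟨μ + q.parts, ?_, ?_⟩) ?_ ?_ ?_
  · intro i hi
    rcases Multiset.mem_add.1 hi with h | h
    · exact hμ i h
    · exact q.parts_pos h
  · rw [Multiset.sum_add, q.parts_sum, hb]
  · intro q hq
    simpa using hq
  · intro q _ q' _ h
    exact Nat.Partition.ext (add_left_cancel (congrArg Nat.Partition.parts h))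
  · intro p hp
    obtain ⟨hle, hQ⟩ := (mem_filter.1 hp).2
    refine ⟨⟨p.parts - μ, fun hi => p.parts_pos (Multiset.mem_of_le tsub_le_self hi), ?_⟩,
      by simpa using hQ, Nat.Partition.ext (add_tsub_cancel_of_le hle)⟩
    have := congrArg Multiset.sum (add_tsub_cancel_of_le hle)
    rw [Multiset.sum_add, p.parts_sum] at this
    omega

theorem forall_count_mul_eq_iff {m : ℕ} (hm : 0 < m) (s ν : Multiset ℕ) :
    (∀ j, s.count (j * m) = ν.count j) ↔
      ν.map (· * m) ≤ s ∧ ∀ i ∈ s - ν.map (· * m), ¬ m ∣ i := by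
  have hc (j : ℕ) : (ν.map (· * m)).count (j * m) = ν.count j :=
    Multiset.count_map_eq_count' _ _ (mul_left_injective₀ hm.ne') j
  constructor
  · intro h
    refine ⟨Multiset.le_iff_count.2 fun i => ?_, ?_⟩
    · by_cases hi : m ∣ i
      · obtain ⟨j, rfl⟩ := hi
        rw [mul_comm, hc, h]
      · rw [Multiset.count_eq_zero_of_notMem]
        · exact Nat.zero_le _
        · simp only [Multiset.mem_map, not_exists, not_and]
          rintro j - rfl
          exact hi (dvd_mul_left m j)
    · rintro i hi ⟨j, rfl⟩
      have := Multiset.count_pos.2 hi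
      rw [Multiset.count_sub, mul_comm, hc, h] at this
      omega
  · rintro ⟨hle, h⟩ j
    have h1 := Multiset.le_iff_count.1 hle (j * m)
    have h2 : (s - ν.map (· * m)).count (j * m) = 0 :=
      Multiset.count_eq_zero.2 fun hi => h _ hi (dvd_mul_left m j)
    rw [Multiset.count_sub] at h2
    rw [hc] at h1 h2
    omega

theorem forall_count_div_eq_iff {m : ℕ} (hm : 0 < m) (s ν : Multiset ℕ) :
    (∀ j, s.count j / m = ν.count j) ↔
      m • ν ≤ s ∧ ∀ i ∈ s - m • ν, (s - m • ν).count i < m := by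
  have key (j : ℕ) : s.count j / m = ν.count j ↔
      m * ν.count j ≤ s.count j ∧ s.count j - m * ν.count j < m := by
    rw [Nat.div_eq_iff hm]
    grind
  simp only [key, Multiset.le_iff_count, Multiset.count_sub, Multiset.count_nsmul, forall_and]
  refine and_congr_right fun _ => ⟨fun h i _ => h i, fun h i => ?_⟩
  by_cases hi : i ∈ s - m • ν
  · exact h i hi
  · have := Multiset.count_eq_zero.2 hi
    rw [Multiset.count_sub, Multiset.count_nsmul] at this
    omega

open Finset Classical in
/-- The families `(t_{jm})_j` and `(⌊t_j / m⌋)_j` are equidistributed over the partitions of `n`. -/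
theorem Nat.Partition.card_count_mul_eq_card_count_div {m : ℕ} (n : ℕ) (hm : 0 < m)
    (ν : Multiset ℕ) (hν : ∀ i ∈ ν, 0 < i) :
    #{p : Nat.Partition n | ∀ j, p.parts.count (j * m) = ν.count j} =
      #{p : Nat.Partition n | ∀ j, p.parts.count j / m = ν.count j} := by
  simp only [forall_count_mul_eq_iff hm, forall_count_div_eq_iff hm]
  have hsum : (ν.map (· * m)).sum = (m • ν).sum := by
    rw [Multiset.sum_map_mul_right, Multiset.sum_nsmul, Multiset.map_id', smul_eq_mul, mul_comm]
  by_cases hb : (m • ν).sum ≤ n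
  · obtain ⟨b, hb⟩ := Nat.exists_eq_add_of_le hb
    rw [card_filter_le_parts (b := b) _ _ (hsum ▸ hb.symm) (fun s => ∀ i ∈ s, ¬ m ∣ i),
      card_filter_le_parts (b := b) _ _ hb.symm (fun s => ∀ i ∈ s, s.count i < m)]
    · exact card_restricted_eq_card_countRestricted b hm
    · exact fun i hi => hν i (Multiset.mem_of_mem_nsmul hi)
    · intro i hi
      obtain ⟨j, hj, rfl⟩ := Multiset.mem_map.1 hi
      exact Nat.mul_pos (hν j hj) hm
  · have hlt (μ : Multiset ℕ) (hμ : μ.sum = (m • ν).sum) (p : Nat.Partition n) :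
        ¬ μ ≤ p.parts := fun h => by
      obtain ⟨t, ht⟩ := Multiset.le_iff_exists_add.1 h
      have := congrArg Multiset.sum ht
      rw [Multiset.sum_add, p.parts_sum] at this
      omega
    simp only [hlt _ hsum, hlt _ rfl, false_and]

open Finset in
theorem Nat.Partition.sum_count_mul_eq_sum_count_div {m : ℕ} (n : ℕ) (hm : 0 < m)
    {M : Type*} [AddCommMonoid M] (g : (ℕ → ℕ) → M) :
    ∑ p : Nat.Partition n, g (fun j => p.parts.count (j * m)) =
      ∑ p : Nat.Partition n, g (fun j => p.parts.count j / m) := by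
  classical
  have hzero (p : Nat.Partition n) (j : ℕ) (hj : j ∉ Icc 1 n) : p.parts.count j = 0 :=
    Multiset.count_eq_zero.2 fun h =>
      hj (mem_Icc.2 ⟨p.parts_pos h, p.le_of_mem_parts h⟩)
  have hcard (f : ℕ → ℕ) :
      #{p : Nat.Partition n | (fun j => p.parts.count (j * m)) = f} =
        #{p : Nat.Partition n | (fun j => p.parts.count j / m) = f} := by
    by_cases hf : ∀ j, j ∉ Icc 1 n → f j = 0
    · have hν (j : ℕ) : (∑ i ∈ Icc 1 n, Multiset.replicate (f i) i).count j = f j := by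
        simp only [Multiset.count_sum', Multiset.count_replicate, Finset.sum_ite_eq']
        grind
      have h := card_count_mul_eq_card_count_div n hm
        (∑ i ∈ Icc 1 n, Multiset.replicate (f i) i) fun i hi => by
          by_contra h0
          rw [← Multiset.count_pos, hν, hf i (by simp; omega)] at hi
          exact hi.false
      simpa only [hν, funext_iff] using h
    · push Not at hf
      obtain ⟨j, hj, hfj⟩ := hf
      have hjm : j * m ∉ Icc 1 n := by
        have := Nat.le_mul_of_pos_right j hm
        rcases Nat.eq_zero_or_pos j with rfl | h
        · simp
        · simp only [mem_Icc] at hj ⊢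
          omega
      rw [filter_false_of_mem, filter_false_of_mem]
      · rintro p - rfl
        exact hfj (by simp [hzero p j hj])
      · rintro p - rfl
        exact hfj (hzero p _ hjm)
  have hmap : (univ : Finset (Nat.Partition n)).val.map (fun p j => p.parts.count (j * m)) =
      (univ : Finset (Nat.Partition n)).val.map (fun p j => p.parts.count j / m) := by
    ext f
    simpa only [Multiset.count_map, eq_comm, card_def, filter_val] using hcard f
  have := congrArg (fun s => (s.map g).sum) hmap
  simpa only [Multiset.map_map] using! this


/-- For positive integers `m`, `n`, `k`:
`Σ_{λ} (-1)^(t_m+t_{2m}+⋯) t_{km}(λ) = Σ_{λ} (-1)^(⌊t_1/m⌋+⌊t_2/m⌋+⋯) ⌊t_k(λ)/m⌋`.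
All terms with index `> n` vanish, so the exponent sums may be taken over `1 ≤ j ≤ n`. -/
theorem stmt_12 (m n k : ℕ) (hm : 0 < m) (hn : 0 < n) (hk : 0 < k) :
    ∑ p : Nat.Partition n,
        (-1 : ℤ) ^ (∑ j ∈ Finset.Icc 1 n, p.parts.count (j * m)) *
          (p.parts.count (k * m) : ℤ)
      = ∑ p : Nat.Partition n,
        (-1 : ℤ) ^ (∑ j ∈ Finset.Icc 1 n, p.parts.count j / m) *
          ((p.parts.count k / m : ℕ) : ℤ) := by
  exact Nat.Partition.sum_count_mul_eq_sum_count_div n hm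
    fun f => (-1 : ℤ) ^ (∑ j ∈ Finset.Icc 1 n, f j) * (f k : ℤ)
end

section
/- Let n be a positive integer, let m ≥ 2 be an integer, and let x_1, x_2, x_3, … be real numbers (only finitely many of the relevant terms are nonzero). Let Q_m(l) denote the set of partitions μ of l in which every part is either equal to 1 or is a multiple of m, and in which the multiplicity t_1(μ) of the part 1 is divisible by m. Then for every nonnegative integer l, Σ_{μ ∈ Q_m(l)} Σ_{j≥1} x_j · t_{jm}(μ) = Σ_{μ ∈ Q_m(l)} Σ_{j≥1} x_j · ⌊t_1(μ)/(jm)⌋. -/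
namespace Nat.Partition

/-- Replace the sub-multiset `s` of the parts of `p` by a multiset `t` of the same sum. -/
def exchange_s14 {l : ℕ} (p : Nat.Partition l) (s t : Multiset ℕ) (hs : s ≤ p.parts)
    (hsum : s.sum = t.sum) (ht : ∀ i ∈ t, 0 < i) : Nat.Partition l where
  parts := p.parts - s + t
  parts_pos {i} hi := by
    rcases Multiset.mem_add.1 hi with h | h
    · exact p.parts_pos (Multiset.mem_of_le (Multiset.sub_le_self _ _) h)
    · exact ht i h
  parts_sum := by
    rw [Multiset.sum_add, ← hsum, ← Multiset.sum_add, Multiset.sub_add_cancel hs, p.parts_sum]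

theorem count_le {l : ℕ} (p : Nat.Partition l) {d : ℕ} (hd : 0 < d) : p.parts.count d ≤ l := by
  have h := Multiset.le_count_iff_replicate_le.1 (le_refl (p.parts.count d))
  obtain ⟨u, hu⟩ := Multiset.le_iff_exists_add.1 h
  have hsum := congrArg Multiset.sum hu
  rw [p.parts_sum, Multiset.sum_add, Multiset.sum_replicate, smul_eq_mul] at hsum
  have hle := Nat.le_mul_of_pos_right (p.parts.count d) hd
  omega

/-- The partitions of `l` whose parts are `1` or multiples of `m`, the number of `1`s being
a multiple of `m`. -/
def oneOrMultiple (m l : ℕ) : Finset (Nat.Partition l) :=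
  Finset.univ.filter fun p => (∀ i ∈ p.parts, i = 1 ∨ m ∣ i) ∧ m ∣ p.parts.count 1

theorem mem_oneOrMultiple {m l : ℕ} {p : Nat.Partition l} :
    p ∈ oneOrMultiple m l ↔ (∀ i ∈ p.parts, i = 1 ∨ m ∣ i) ∧ m ∣ p.parts.count 1 := by
  simp [oneOrMultiple]

/-- Trading `k` parts equal to `d` for `k * d` parts equal to `1` is a bijection. -/
theorem card_filter_le_count_eq {m d : ℕ} (l k : ℕ) (hd : 1 < d) (hmd : m ∣ d) :
    ((oneOrMultiple m l).filter fun p => k ≤ p.parts.count d).card =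
      ((oneOrMultiple m l).filter fun p => k * d ≤ p.parts.count 1).card := by
  have hsum : (Multiset.replicate k d).sum = (Multiset.replicate (k * d) 1).sum := by simp
  refine Finset.card_bij'
    (fun p hp => p.exchange_s14 (Multiset.replicate k d) (Multiset.replicate (k * d) 1)
      (Multiset.le_count_iff_replicate_le.1 (Finset.mem_filter.1 hp).2) hsum
      fun i hi => by rw [Multiset.eq_of_mem_replicate hi]; exact one_pos)
    (fun p hp => p.exchange_s14 (Multiset.replicate (k * d) 1) (Multiset.replicate k d)
      (Multiset.le_count_iff_replicate_le.1 (Finset.mem_filter.1 hp).2) hsum.symm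
      fun i hi => by rw [Multiset.eq_of_mem_replicate hi]; exact hd.le)
    ?_ ?_ ?_ ?_
  · intro p hp
    obtain ⟨hq, -⟩ := Finset.mem_filter.1 hp
    obtain ⟨hparts, hone⟩ := mem_oneOrMultiple.1 hq
    refine Finset.mem_filter.2 ⟨mem_oneOrMultiple.2 ⟨fun i hi => ?_, ?_⟩, ?_⟩
    · rcases Multiset.mem_add.1 hi with h | h
      · exact hparts i (Multiset.mem_of_le (Multiset.sub_le_self _ _) h)
      · exact Or.inl (Multiset.eq_of_mem_replicate h)
    · simpa [exchange_s14, Multiset.count_replicate, hd.ne'] using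
        (Nat.dvd_add hone (hmd.mul_left k))
    · simp [exchange_s14]
  · intro p hp
    obtain ⟨hq, -⟩ := Finset.mem_filter.1 hp
    obtain ⟨hparts, hone⟩ := mem_oneOrMultiple.1 hq
    refine Finset.mem_filter.2 ⟨mem_oneOrMultiple.2 ⟨fun i hi => ?_, ?_⟩, ?_⟩
    · rcases Multiset.mem_add.1 hi with h | h
      · exact hparts i (Multiset.mem_of_le (Multiset.sub_le_self _ _) h)
      · exact Or.inr (Multiset.eq_of_mem_replicate h ▸ hmd)
    · simpa [exchange_s14, Multiset.count_replicate, hd.ne'] using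
        (Nat.dvd_sub hone (hmd.mul_left k))
    · simp [exchange_s14]
  · intro p hp
    refine Nat.Partition.ext ?_
    simp only [exchange_s14, Multiset.add_sub_cancel_right]
    exact Multiset.sub_add_cancel
      (Multiset.le_count_iff_replicate_le.1 (Finset.mem_filter.1 hp).2)
  · intro p hp
    refine Nat.Partition.ext ?_
    simp only [exchange_s14, Multiset.add_sub_cancel_right]
    exact Multiset.sub_add_cancel
      (Multiset.le_count_iff_replicate_le.1 (Finset.mem_filter.1 hp).2)

theorem sum_count_eq_sum_count_one_div {m d : ℕ} (l : ℕ) (hd : 1 < d) (hmd : m ∣ d) :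
    ∑ p ∈ oneOrMultiple m l, p.parts.count d =
      ∑ p ∈ oneOrMultiple m l, p.parts.count 1 / d := by
  have card_le : ∀ c ≤ l, ((Finset.Icc 1 l).filter fun k => k ≤ c).card = c := by
    intro c hc
    have : (Finset.Icc 1 l).filter (fun k => k ≤ c) = Finset.Icc 1 c := by
      ext k
      simp only [Finset.mem_filter, Finset.mem_Icc]
      omega
    rw [this, Nat.card_Icc, Nat.add_sub_cancel]
  calc ∑ p ∈ oneOrMultiple m l, p.parts.count d
      = ∑ p ∈ oneOrMultiple m l, ((Finset.Icc 1 l).filter fun k => k ≤ p.parts.count d).card :=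
        Finset.sum_congr rfl fun p _ => (card_le _ (p.count_le (by omega))).symm
    _ = ∑ k ∈ Finset.Icc 1 l, ((oneOrMultiple m l).filter fun p => k ≤ p.parts.count d).card :=
        Finset.sum_card_bipartiteAbove_eq_sum_card_bipartiteBelow _
    _ = ∑ k ∈ Finset.Icc 1 l,
          ((oneOrMultiple m l).filter fun p => k ≤ p.parts.count 1 / d).card := by
        simp only [card_filter_le_count_eq l _ hd hmd,
          Nat.le_div_iff_mul_le (zero_lt_one.trans hd)]
    _ = ∑ p ∈ oneOrMultiple m l,
          ((Finset.Icc 1 l).filter fun k => k ≤ p.parts.count 1 / d).card :=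
        (Finset.sum_card_bipartiteAbove_eq_sum_card_bipartiteBelow _).symm
    _ = ∑ p ∈ oneOrMultiple m l, p.parts.count 1 / d :=
        Finset.sum_congr rfl fun p _ =>
          card_le _ ((Nat.div_le_self _ _).trans (p.count_le one_pos))

end Nat.Partition


/-- For an integer `m ≥ 2`, real numbers `x_1, x_2, …`, and any nonnegative integer `l`:
letting `Q_m(l)` be the set of partitions `μ` of `l` in which every part equals `1` or is a
multiple of `m`, and with `m ∣ t_1(μ)`, we have
`Σ_{μ ∈ Q_m(l)} Σ_{j≥1} x_j t_{jm}(μ) = Σ_{μ ∈ Q_m(l)} Σ_{j≥1} x_j ⌊t_1(μ)/(jm)⌋`.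
All terms with `jm > l` vanish, so the inner sums may be taken over `1 ≤ j ≤ l`.
(The hypothesis that `n` is a positive integer plays no role in the identity, which
is stated for every nonnegative integer `l`.) -/
theorem stmt_14 (n : ℕ) (hn : 0 < n) (m : ℕ) (hm : 2 ≤ m) (x : ℕ → ℝ) (l : ℕ) :
    ∑ p ∈ Finset.univ.filter
        (fun p : Nat.Partition l =>
          (∀ i ∈ p.parts, i = 1 ∨ m ∣ i) ∧ m ∣ p.parts.count 1),
      ∑ j ∈ Finset.Icc 1 l, x j * (p.parts.count (j * m) : ℝ)
    = ∑ p ∈ Finset.univ.filter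
        (fun p : Nat.Partition l =>
          (∀ i ∈ p.parts, i = 1 ∨ m ∣ i) ∧ m ∣ p.parts.count 1),
      ∑ j ∈ Finset.Icc 1 l, x j * ((p.parts.count 1 / (j * m) : ℕ) : ℝ) := by
  rw [Finset.sum_comm, Finset.sum_comm (t := Finset.Icc 1 l)]
  refine Finset.sum_congr rfl fun j hj => ?_
  have hj1 : 1 ≤ j := (Finset.mem_Icc.1 hj).1
  rw [← Finset.mul_sum, ← Finset.mul_sum]
  congr 1
  exact_mod_cast Nat.Partition.sum_count_eq_sum_count_one_div l
    (show 1 < j * m by nlinarith) (Dvd.intro_left j rfl)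
end
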